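/- Let f : ℝ² → ℍ be integrable and have partial derivatives in the L¹ norm of all orders ≤ 3 (i.e. all iterated L¹-norm partial derivatives ∂^{m+n} f/(∂s^m ∂t^n) with m+n ≤ 3 exist and are integrable). Then the two-sided quaternion Fourier transform 𝓕_T of f is integrable, and f(s,t) = (1/(4π²)) ∫_{ℝ²} e^{i s u} 𝓕_T(u,v) e^{j t v} du dv for almost every (s,t) ∈ ℝ². -/

import Mathlib

open MeasureTheory Filter Real Set
open scoped Quaternion Topology

noncomputable section

def qi : ℍ[ℝ] := ⟨0,1,0,0⟩
def qj : ℍ[ℝ] := ⟨0,0,1,0⟩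

/-- `e^{μθ} = cos θ + μ sin θ` for a (pure unit) quaternion `μ`. -/
def qexp (μ : ℍ[ℝ]) (θ : ℝ) : ℍ[ℝ] := (Real.cos θ : ℍ[ℝ]) + Real.sin θ • μ

/-- Two-sided quaternion Fourier transform. -/
def QFT_T (f : ℝ × ℝ → ℍ[ℝ]) (u v : ℝ) : ℍ[ℝ] :=
  ∫ p : ℝ × ℝ, qexp qi (-(u * p.1)) * f p * qexp qj (-(v * p.2))


/-- `g` is the partial derivative of `f` with respect to the first variable in the `L¹` norm. -/
def L1PartialDerivS (f g : ℝ × ℝ → ℍ[ℝ]) : Prop :=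
  Tendsto (fun h : ℝ => ∫ p : ℝ × ℝ, ‖h⁻¹ • (f (p.1 + h, p.2) - f p) - g p‖)
    (𝓝[≠] (0:ℝ)) (𝓝 0)

/-- `g` is the partial derivative of `f` with respect to the second variable in the `L¹` norm. -/
def L1PartialDerivT (f g : ℝ × ℝ → ℍ[ℝ]) : Prop :=
  Tendsto (fun h : ℝ => ∫ p : ℝ × ℝ, ‖h⁻¹ • (f (p.1, p.2 + h) - f p) - g p‖)
    (𝓝[≠] (0:ℝ)) (𝓝 0)

/-- `D` is a family of iterated `L¹`-norm partial derivatives of `f` of all total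
orders `≤ N`, with `D k l` the derivative taken `k` times in `s` and `l` times in `t`. -/
def HasL1DerivsUpTo (N : ℕ) (f : ℝ × ℝ → ℍ[ℝ]) (D : ℕ → ℕ → (ℝ × ℝ → ℍ[ℝ])) : Prop :=
  D 0 0 = f ∧
  (∀ k l : ℕ, k + l ≤ N → Integrable (D k l)) ∧
  (∀ k l : ℕ, k + 1 + l ≤ N → L1PartialDerivS (D k l) (D (k + 1) l)) ∧
  (∀ k l : ℕ, k + l + 1 ≤ N → L1PartialDerivT (D k l) (D k (l + 1)))



open scoped FourierTransform ContDiff in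
lemma fourierInv_fourier_ae {V : Type*} [NormedAddCommGroup V] [InnerProductSpace ℝ V]
    [FiniteDimensional ℝ V] [MeasurableSpace V] [BorelSpace V]
    (G : V → ℂ) (hG : Integrable G) (hFG : Integrable (𝓕 G)) :
    ∀ᵐ x, G x = 𝓕⁻ (𝓕 G) x := by
  have adj : ∀ a b : V → ℂ, Integrable a → Integrable b →
      ∫ ξ, 𝓕 a ξ • b ξ = ∫ x, a x • 𝓕 b x := by
    intro a b ha hb
    simpa using! VectorFourier.integral_fourierIntegral_smul_eq_flip (L := innerₗ V)
      continuous_fourierChar continuous_inner ha hb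
  have hcont : Continuous (𝓕⁻ (𝓕 G)) := by
    have : Continuous (𝓕 (𝓕 G)) :=
      VectorFourier.fourierIntegral_continuous Real.continuous_fourierChar
        (innerSL ℝ).continuous₂ hFG
    have h2 : 𝓕⁻ (𝓕 G) = fun x => 𝓕 (𝓕 G) (-x) := by
      ext x; exact fourierInv_eq_fourier_neg _ _
    rw [h2]; exact this.comp continuous_neg
  apply ae_eq_of_integral_contDiff_smul_eq hG.locallyIntegrable hcont.locallyIntegrable
  intro g g_smooth g_cpt
  have hg₁ : HasCompactSupport (Complex.ofRealCLM ∘ g) := g_cpt.comp_left rfl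
  have hg₂ : ContDiff ℝ ∞ (Complex.ofRealCLM ∘ g) := by fun_prop
  set Φ : SchwartzMap V ℂ := hg₁.toSchwartzMap hg₂ with hΦ
  have hΦg : ∀ x, Φ x = (g x : ℂ) := fun x => rfl
  set Ψ : SchwartzMap V ℂ := 𝓕⁻ Φ with hΨ
  have h1 : (Φ : V → ℂ) = 𝓕 (Ψ : V → ℂ) := by
    rw [← SchwartzMap.fourier_coe, hΨ, FourierTransform.fourier_fourierInv_eq]
  have h2 : (Ψ : V → ℂ) = 𝓕 (fun x => Φ (-x)) := by
    rw [hΨ, SchwartzMap.fourierInv_coe, fourierInv_eq_fourier_comp_neg]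
  calc ∫ x, g x • G x = ∫ x, 𝓕 (Ψ : V → ℂ) x • G x := by
        rw [← h1]; simp [hΦg]
    _ = ∫ x, Ψ x • 𝓕 G x := adj _ _ Ψ.integrable hG
    _ = ∫ x, Φ (-x) • 𝓕 (𝓕 G) x := by
        rw [h2]; exact adj _ _ Φ.integrable.comp_neg hFG
    _ = ∫ x, Φ (x) • 𝓕 (𝓕 G) (-x) := by
        rw [← integral_neg_eq_self]; simp
    _ = _ := by
        simp [fourierInv_eq_fourier_neg, hΦg]

abbrev V2 := WithLp 2 (ℝ × ℝ)

open scoped FourierTransform in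
lemma cinv (g : ℝ × ℝ → ℂ) (hg : Integrable g)
    (F : ℝ × ℝ → ℂ)
    (hF : ∀ q, F q = ∫ p : ℝ × ℝ, Complex.exp ((-(q.1*p.1+q.2*p.2) : ℝ) * Complex.I) * g p)
    (hFi : Integrable F) :
    ∀ᵐ p : ℝ × ℝ, g p = (1 / (4 * π^2)) •
      ∫ q : ℝ × ℝ, Complex.exp (((p.1*q.1+p.2*q.2) : ℝ) * Complex.I) * F q := by
  have mp := WithLp.volume_preserving_ofLp ℝ ℝ
  have me : MeasurableEmbedding (@WithLp.ofLp 2 (ℝ × ℝ)) :=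
    (MeasurableEquiv.toLp 2 (ℝ × ℝ)).symm.measurableEmbedding
  have hin : ∀ x y : V2, inner ℝ x y = (y.ofLp.1 * x.ofLp.1 + y.ofLp.2 * x.ofLp.2 : ℝ) := by
    intro x y; simp [WithLp.prod_inner_apply]
  set G : V2 → ℂ := fun x => g x.ofLp with hGdef
  have hG : Integrable G := (mp.integrable_comp_emb me).2 hg
  have hFG : ∀ w : V2, 𝓕 G w = F ((2 * π) • w.ofLp) := by
    intro w
    rw [Real.fourier_eq', hF, ← mp.integral_comp me]
    congr 1; ext x
    rw [hin, smul_eq_mul]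
    simp only [hGdef, Prod.smul_fst, Prod.smul_snd, smul_eq_mul]
    congr 4; ring
  have hFGi : Integrable (𝓕 G) := by
    rw [show 𝓕 G = (fun q => F ((2 * π) • q)) ∘ WithLp.ofLp from funext hFG]
    exact (mp.integrable_comp_emb me).2 (hFi.comp_smul (by positivity))
  have key := fourierInv_fourier_ae G hG hFGi
  have key2 := (WithLp.volume_preserving_toLp ℝ ℝ).quasiMeasurePreserving.ae key
  filter_upwards [key2] with p hp
  have : g p = G (WithLp.toLp 2 p) := rfl
  rw [this, hp, Real.fourierInv_eq']
  simp only [hFG, hin, smul_eq_mul]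
  have h3 := mp.integral_comp me (fun q : ℝ × ℝ => Complex.exp ((((2 * π) * (p.1 * q.1 + p.2 * q.2) : ℝ)) * Complex.I) * F ((2 * π) • q))
  rw [h3]
  have h4 := Measure.integral_comp_smul (volume : Measure (ℝ × ℝ)) (fun q : ℝ × ℝ => Complex.exp (((p.1*q.1+p.2*q.2) : ℝ) * Complex.I) * F q) (2 * π)
  have h5 : |((2 * π) ^ Module.finrank ℝ (ℝ × ℝ))⁻¹| = 1 / (4 * π^2) := by
    simp only [Module.finrank_prod, Module.finrank_self]
    rw [abs_of_nonneg (by positivity)]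
    norm_num
    ring
  rw [h5] at h4
  rw [← h4]
  congr 1; ext q
  simp only [Prod.smul_fst, Prod.smul_snd, smul_eq_mul]
  congr 4; ring

@[simp] lemma qi_re : qi.re = 0 := rfl
@[simp] lemma qi_imI : qi.imI = 1 := rfl
@[simp] lemma qi_imJ : qi.imJ = 0 := rfl
@[simp] lemma qi_imK : qi.imK = 0 := rfl
@[simp] lemma qj_re : qj.re = 0 := rfl
@[simp] lemma qj_imI : qj.imI = 0 := rfl
@[simp] lemma qj_imJ : qj.imJ = 1 := rfl
@[simp] lemma qj_imK : qj.imK = 0 := rfl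

lemma cexp_mk (θ : ℝ) : Complex.exp (θ * Complex.I) = ⟨Real.cos θ, Real.sin θ⟩ := by
  apply Complex.ext
  · exact Complex.exp_ofReal_mul_I_re θ
  · exact Complex.exp_ofReal_mul_I_im θ

lemma qexp_continuous (μ : ℍ[ℝ]) : Continuous (qexp μ) := by
  unfold qexp
  have : Continuous (fun x : ℝ => (x : ℍ[ℝ])) := Quaternion.continuous_coe
  exact (this.comp Real.continuous_cos).add (Real.continuous_sin.smul continuous_const)

lemma norm_qexp_qi (θ : ℝ) : ‖qexp qi θ‖ = 1 := by
  have : ‖qexp qi θ‖ * ‖qexp qi θ‖ = 1 := by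
    rw [← Quaternion.normSq_eq_norm_mul_self, Quaternion.normSq_def']
    simp [qexp]
  nlinarith [norm_nonneg (qexp qi θ)]

lemma norm_qexp_qj (θ : ℝ) : ‖qexp qj θ‖ = 1 := by
  have : ‖qexp qj θ‖ * ‖qexp qj θ‖ = 1 := by
    rw [← Quaternion.normSq_eq_norm_mul_self, Quaternion.normSq_def']
    simp [qexp]
  nlinarith [norm_nonneg (qexp qj θ)]

lemma norm_qi : ‖qi‖ = 1 := by
  have := norm_qexp_qi (π / 2)
  simpa [qexp] using this

lemma norm_qj : ‖qj‖ = 1 := by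
  have := norm_qexp_qj (π / 2)
  simpa [qexp] using this

lemma qexp_qi_add (a b : ℝ) : qexp qi (a + b) = qexp qi a * qexp qi b := by
  ext <;> simp [qexp, Real.cos_add, Real.sin_add] <;> ring

lemma qexp_qj_add (a b : ℝ) : qexp qj (a + b) = qexp qj a * qexp qj b := by
  ext <;> simp [qexp, Real.cos_add, Real.sin_add] <;> ring

lemma qexp_slope (μ : ℍ[ℝ]) (u : ℝ) :
    Tendsto (fun h : ℝ => h⁻¹ • (qexp μ (u * h) - 1)) (𝓝[≠] 0) (𝓝 (u • μ)) := by
  have h1 : HasDerivAt (fun h : ℝ => qexp μ (u * h)) (u • μ) 0 := by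
    have hc : HasDerivAt (fun h : ℝ => Real.cos (u * h)) 0 0 := by
      simpa using (((hasDerivAt_id (0:ℝ)).const_mul u).cos)
    have hs : HasDerivAt (fun h : ℝ => Real.sin (u * h)) u 0 := by
      simpa using (((hasDerivAt_id (0:ℝ)).const_mul u).sin)
    have := (hc.smul_const (1 : ℍ[ℝ])).add (hs.smul_const μ)
    convert! this using 1
    · ext h <;> simp [qexp]
    · simp
  have := hasDerivAt_iff_tendsto_slope_zero.1 h1
  simpa [qexp] using this

def kern (f : ℝ × ℝ → ℍ[ℝ]) (u v : ℝ) (p : ℝ × ℝ) : ℍ[ℝ] :=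
  qexp qi (-(u * p.1)) * f p * qexp qj (-(v * p.2))

lemma norm_kern (f : ℝ × ℝ → ℍ[ℝ]) (u v : ℝ) (p : ℝ × ℝ) : ‖kern f u v p‖ = ‖f p‖ := by
  simp [kern, norm_qexp_qi, norm_qexp_qj]

lemma integrable_sandwich {f : ℝ × ℝ → ℍ[ℝ]} (hf : Integrable f) {a b : ℝ × ℝ → ℝ}
    (ha : Continuous a) (hb : Continuous b) :
    Integrable (fun p => qexp qi (a p) * f p * qexp qj (b p)) := by
  refine hf.mono ?_ (Eventually.of_forall fun p => ?_)
  · exact ((((qexp_continuous qi).comp ha).aestronglyMeasurable).mul hf.1).mul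
      ((qexp_continuous qj).comp hb).aestronglyMeasurable
  · simp [norm_qexp_qi, norm_qexp_qj]

lemma integrable_kern {f : ℝ × ℝ → ℍ[ℝ]} (hf : Integrable f) (u v : ℝ) :
    Integrable (kern f u v) :=
  integrable_sandwich hf (by fun_prop) (by fun_prop)

lemma QFT_eq (f : ℝ × ℝ → ℍ[ℝ]) (u v : ℝ) : QFT_T f u v = ∫ p, kern f u v p := rfl

lemma norm_QFT_le (f : ℝ × ℝ → ℍ[ℝ]) (u v : ℝ) : ‖QFT_T f u v‖ ≤ ∫ p, ‖f p‖ := by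
  rw [QFT_eq]
  refine (norm_integral_le_integral_norm _).trans (le_of_eq ?_)
  simp [norm_kern]

lemma QFT_sub {f g : ℝ × ℝ → ℍ[ℝ]} (hf : Integrable f) (hg : Integrable g) (u v : ℝ) :
    QFT_T (fun p => f p - g p) u v = QFT_T f u v - QFT_T g u v := by
  simp only [QFT_eq]
  rw [← integral_sub (integrable_kern hf u v) (integrable_kern hg u v)]
  simp [kern, mul_sub, sub_mul]

lemma QFT_smul (f : ℝ × ℝ → ℍ[ℝ]) (c : ℝ) (u v : ℝ) :
    QFT_T (fun p => c • f p) u v = c • QFT_T f u v := by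
  simp only [QFT_eq]
  rw [← integral_smul]
  simp [kern]

lemma QFT_shift (f : ℝ × ℝ → ℍ[ℝ]) (hf : Integrable f) (a b u v : ℝ) :
    QFT_T (fun p => f (p.1 + a, p.2 + b)) u v
      = qexp qi (u * a) * QFT_T f u v * qexp qj (v * b) := by
  have h1 : ∀ p : ℝ × ℝ, kern (fun p => f (p.1 + a, p.2 + b)) u v p =
      (fun p => qexp qi (u * a) * kern f u v p * qexp qj (v * b)) (p + (a, b)) := by
    intro p
    have e1 : -(u * p.1) = u * a + -(u * (p.1 + a)) := by ring
    have e2 : -(v * p.2) = -(v * (p.2 + b)) + v * b := by ring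
    simp only [kern, Prod.fst_add, Prod.snd_add]
    rw [e1, e2, qexp_qi_add, qexp_qj_add]
    simp only [mul_assoc]
    rfl
  simp only [QFT_eq, h1]
  rw [integral_add_right_eq_self (μ := (volume : Measure (ℝ × ℝ)))
    (fun p => qexp qi (u * a) * kern f u v p * qexp qj (v * b)) (a, b)]
  have hk := integrable_kern hf u v
  rw [integral_mul_const_of_integrable (hk.const_mul _), integral_const_mul_of_integrable hk]

lemma integrable_shift {f : ℝ × ℝ → ℍ[ℝ]} (hf : Integrable f) (a b : ℝ) :
    Integrable (fun p : ℝ × ℝ => f (p.1 + a, p.2 + b)) :=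
  hf.comp_add_right (a, b)

lemma QFT_lim {f g : ℝ × ℝ → ℍ[ℝ]} (hf : Integrable f) (hg : Integrable g) (a b : ℝ)
    (H : Tendsto (fun h : ℝ => ∫ p : ℝ × ℝ, ‖h⁻¹ • (f (p.1 + a * h, p.2 + b * h) - f p) - g p‖)
      (𝓝[≠] (0:ℝ)) (𝓝 0)) (u v : ℝ) :
    Tendsto (fun h : ℝ => h⁻¹ • (qexp qi (u * (a * h)) * QFT_T f u v * qexp qj (v * (b * h))
      - QFT_T f u v)) (𝓝[≠] (0:ℝ)) (𝓝 (QFT_T g u v)) := by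
  rw [tendsto_iff_norm_sub_tendsto_zero]
  refine squeeze_zero (fun _ => norm_nonneg _) (fun h => ?_) H
  rw [← QFT_shift f hf, ← QFT_sub (integrable_shift hf _ _) hf, ← QFT_smul,
    ← QFT_sub (f := fun p => h⁻¹ • (f (p.1 + a * h, p.2 + b * h) - f p))
      (((integrable_shift hf (a * h) (b * h)).sub hf).smul h⁻¹) hg]
  exact norm_QFT_le _ _ _

lemma QFT_derivS {f g : ℝ × ℝ → ℍ[ℝ]} (hf : Integrable f) (hg : Integrable g)
    (H : L1PartialDerivS f g) (u v : ℝ) : ‖QFT_T g u v‖ = |u| * ‖QFT_T f u v‖ := by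
  have h1 := QFT_lim hf hg 1 0 (by simpa [L1PartialDerivS] using H) u v
  have h2 := (qexp_slope qi u).mul_const (QFT_T f u v)
  have : QFT_T g u v = (u • qi) * QFT_T f u v := by
    refine tendsto_nhds_unique h1 (h2.congr fun h => ?_)
    simp [qexp, sub_mul]
  rw [this, norm_mul, norm_smul, norm_qi]; simp

lemma QFT_derivT {f g : ℝ × ℝ → ℍ[ℝ]} (hf : Integrable f) (hg : Integrable g)
    (H : L1PartialDerivT f g) (u v : ℝ) : ‖QFT_T g u v‖ = |v| * ‖QFT_T f u v‖ := by
  have h1 := QFT_lim hf hg 0 1 (by simpa [L1PartialDerivT] using H) u v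
  have h2 := (qexp_slope qj v).const_mul (QFT_T f u v)
  have : QFT_T g u v = QFT_T f u v * (v • qj) := by
    refine tendsto_nhds_unique h1 (h2.congr fun h => ?_)
    simp [qexp, mul_sub]
  rw [this, norm_mul, norm_smul, norm_qj]; simp [mul_comm]

lemma QFT_continuous {f : ℝ × ℝ → ℍ[ℝ]} (hf : Integrable f) :
    Continuous (fun q : ℝ × ℝ => QFT_T f q.1 q.2) := by
  simp only [QFT_eq]
  refine continuous_of_dominated (bound := fun p => ‖f p‖)
    (fun q => (integrable_kern hf _ _).1) (fun q => Eventually.of_forall fun p => ?_) hf.norm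
    (Eventually.of_forall fun p => ?_)
  · rw [norm_kern]
  · have h1 : Continuous fun q : ℝ × ℝ => qexp qi (-(q.1 * p.1)) :=
      (qexp_continuous qi).comp (by fun_prop)
    have h2 : Continuous fun q : ℝ × ℝ => qexp qj (-(q.2 * p.2)) :=
      (qexp_continuous qj).comp (by fun_prop)
    exact (h1.mul continuous_const).mul h2

lemma QFT_integrable {f : ℝ × ℝ → ℍ[ℝ]} (hf : Integrable f)
    (D : ℕ → ℕ → (ℝ × ℝ → ℍ[ℝ])) (hD : HasL1DerivsUpTo 3 f D) :
    Integrable (fun p : ℝ × ℝ => QFT_T f p.1 p.2) := by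
  obtain ⟨h0, hI, hS, hT⟩ := hD
  have hu : ∀ u v, |u| ^ 3 * ‖QFT_T f u v‖ ≤ ∫ p, ‖D 3 0 p‖ := by
    intro u v
    refine le_trans (le_of_eq ?_) (norm_QFT_le (D 3 0) u v)
    rw [QFT_derivS (hI 2 0 (by norm_num)) (hI 3 0 (by norm_num)) (hS 2 0 (by norm_num)),
      QFT_derivS (hI 1 0 (by norm_num)) (hI 2 0 (by norm_num)) (hS 1 0 (by norm_num)),
      QFT_derivS (hI 0 0 (by norm_num)) (hI 1 0 (by norm_num)) (hS 0 0 (by norm_num)), h0]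
    ring
  have hv : ∀ u v, |v| ^ 3 * ‖QFT_T f u v‖ ≤ ∫ p, ‖D 0 3 p‖ := by
    intro u v
    refine le_trans (le_of_eq ?_) (norm_QFT_le (D 0 3) u v)
    rw [QFT_derivT (hI 0 2 (by norm_num)) (hI 0 3 (by norm_num)) (hT 0 2 (by norm_num)),
      QFT_derivT (hI 0 1 (by norm_num)) (hI 0 2 (by norm_num)) (hT 0 1 (by norm_num)),
      QFT_derivT (hI 0 0 (by norm_num)) (hI 0 1 (by norm_num)) (hT 0 0 (by norm_num)), h0]
    ring
  set C := 8 * ((∫ p, ‖f p‖) + (∫ p, ‖D 3 0 p‖) + ∫ p, ‖D 0 3 p‖) with hC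
  have hint : Integrable (fun p : ℝ × ℝ => C * (1 + ‖p‖) ^ (-(3:ℝ))) :=
    (integrable_one_add_norm (by simp; norm_num)).const_mul C
  refine hint.mono' (QFT_continuous hf).aestronglyMeasurable (Eventually.of_forall fun p => ?_)
  have hn : 0 ≤ ‖p‖ := norm_nonneg p
  rw [Real.rpow_neg (by positivity), ← div_eq_mul_inv, le_div_iff₀ (by positivity)]
  norm_cast
  have h3 : (1 + ‖p‖) ^ 3 ≤ 8 * (1 + |p.1| ^ 3 + |p.2| ^ 3) := by
    have h4 : ‖p‖ ^ 3 ≤ |p.1| ^ 3 + |p.2| ^ 3 := by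
      rw [Prod.norm_def]
      have := abs_nonneg p.1
      have := abs_nonneg p.2
      rcases max_choice ‖p.1‖ ‖p.2‖ with h | h <;> rw [h, Real.norm_eq_abs]
      · have := pow_nonneg (abs_nonneg p.2) 3; linarith
      · have := pow_nonneg (abs_nonneg p.1) 3; linarith
    nlinarith [sq_nonneg (‖p‖ - 1), mul_nonneg hn (sq_nonneg (‖p‖ - 1))]
  have := hu p.1 p.2
  have := hv p.1 p.2
  have := norm_QFT_le f p.1 p.2
  calc ‖QFT_T f p.1 p.2‖ * (1 + ‖p‖) ^ 3
      ≤ ‖QFT_T f p.1 p.2‖ * (8 * (1 + |p.1| ^ 3 + |p.2| ^ 3)) := by gcongr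
    _ ≤ C := by rw [hC]; linarith

/-- The component of a quaternion on which `i q j = q`. -/
def Pc : ℍ[ℝ] →L[ℝ] ℂ := LinearMap.toContinuousLinearMap
  { toFun := fun q => ⟨q.re + q.imK, q.imI - q.imJ⟩
    map_add' := by intro x y; apply Complex.ext <;> simp <;> ring
    map_smul' := by intro c x; apply Complex.ext <;> simp <;> ring }

/-- The component of a quaternion on which `i q j = -q`. -/
def Mc : ℍ[ℝ] →L[ℝ] ℂ := LinearMap.toContinuousLinearMap
  { toFun := fun q => ⟨q.re - q.imK, q.imI + q.imJ⟩
    map_add' := by intro x y; apply Complex.ext <;> simp <;> ring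
    map_smul' := by intro c x; apply Complex.ext <;> simp <;> ring }

lemma Pc_apply (q : ℍ[ℝ]) : Pc q = ⟨q.re + q.imK, q.imI - q.imJ⟩ := rfl
lemma Mc_apply (q : ℍ[ℝ]) : Mc q = ⟨q.re - q.imK, q.imI + q.imJ⟩ := rfl

lemma PM_inj {q r : ℍ[ℝ]} (h1 : Pc q = Pc r) (h2 : Mc q = Mc r) : q = r := by
  simp only [Pc_apply, Mc_apply, Complex.mk.injEq] at h1 h2
  ext <;> linarith [h1.1, h1.2, h2.1, h2.2]

lemma Pc_sandwich (a b : ℝ) (q : ℍ[ℝ]) :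
    Pc (qexp qi a * q * qexp qj b) = Complex.exp ((a - b : ℝ) * Complex.I) * Pc q := by
  rw [cexp_mk, Real.cos_sub, Real.sin_sub]
  apply Complex.ext <;> simp [Pc_apply, qexp] <;> ring

lemma Mc_sandwich (a b : ℝ) (q : ℍ[ℝ]) :
    Mc (qexp qi a * q * qexp qj b) = Complex.exp ((a + b : ℝ) * Complex.I) * Mc q := by
  rw [cexp_mk, Real.cos_add, Real.sin_add]
  apply Complex.ext <;> simp [Mc_apply, qexp] <;> ring


lemma Mc_QFT {f : ℝ × ℝ → ℍ[ℝ]} (hf : Integrable f) (q : ℝ × ℝ) :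
    Mc (QFT_T f q.1 q.2) =
      ∫ p : ℝ × ℝ, Complex.exp ((-(q.1*p.1+q.2*p.2) : ℝ) * Complex.I) * Mc (f p) := by
  rw [QFT_eq, ← Mc.integral_comp_comm (integrable_kern hf _ _)]
  congr 1; ext p
  rw [kern, Mc_sandwich]
  congr 4; ring

lemma measurePreserving_flip :
    MeasurePreserving (fun p : ℝ × ℝ => (p.1, -p.2)) :=
  (MeasurePreserving.id (volume : Measure ℝ)).prod (Measure.measurePreserving_neg volume)

lemma measurableEmbedding_flip :
    MeasurableEmbedding (fun p : ℝ × ℝ => (p.1, -p.2)) :=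
  ((MeasurableEquiv.refl ℝ).prodCongr (MeasurableEquiv.neg ℝ)).measurableEmbedding

lemma Pc_QFT {f : ℝ × ℝ → ℍ[ℝ]} (hf : Integrable f) (q : ℝ × ℝ) :
    Pc (QFT_T f q.1 q.2) =
      ∫ p : ℝ × ℝ, Complex.exp ((-(q.1*p.1+q.2*p.2) : ℝ) * Complex.I) * Pc (f (p.1, -p.2)) := by
  rw [QFT_eq, ← Pc.integral_comp_comm (integrable_kern hf _ _),
    ← measurePreserving_flip.integral_comp measurableEmbedding_flip]
  congr 1; ext p
  rw [kern, Pc_sandwich]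
  congr 4; ring

/-- If an integrable `f` has all iterated `L¹`-norm partial derivatives of total order `≤ 3`,
then its two-sided QFT is integrable and `f` is recovered a.e. by the inversion integral. -/
theorem qft_two_sided_inversion_of_L1_derivs
    (f : ℝ × ℝ → ℍ[ℝ]) (hf : Integrable f)
    (D : ℕ → ℕ → (ℝ × ℝ → ℍ[ℝ])) (hD : HasL1DerivsUpTo 3 f D) :
    Integrable (fun p : ℝ × ℝ => QFT_T f p.1 p.2) ∧
    ∀ᵐ p : ℝ × ℝ, f p =
      (1 / (4 * π ^ 2)) • ∫ q : ℝ × ℝ, qexp qi (p.1 * q.1) * QFT_T f q.1 q.2 * qexp qj (p.2 * q.2) := by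
  have hF := QFT_integrable hf D hD
  refine ⟨hF, ?_⟩
  have hM := cinv (fun p => Mc (f p)) (Mc.integrable_comp hf)
    (fun q => Mc (QFT_T f q.1 q.2)) (Mc_QFT hf) (Mc.integrable_comp hF)
  have hP := cinv (fun p => Pc (f (p.1, -p.2)))
    ((measurePreserving_flip.integrable_comp_emb measurableEmbedding_flip).2
      (Pc.integrable_comp hf))
    (fun q => Pc (QFT_T f q.1 q.2)) (Pc_QFT hf) (Pc.integrable_comp hF)
  have hP' := measurePreserving_flip.quasiMeasurePreserving.ae hP
  filter_upwards [hM, hP'] with p h1 h2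
  have hI : Integrable (fun q : ℝ × ℝ =>
      qexp qi (p.1 * q.1) * QFT_T f q.1 q.2 * qexp qj (p.2 * q.2)) :=
    integrable_sandwich hF (by fun_prop) (by fun_prop)
  apply PM_inj
  · simp only [neg_neg] at h2
    rw [map_smul, ← Pc.integral_comp_comm hI, h2]
    congr 2; ext q
    rw [Pc_sandwich]
    congr 4; ring
  · rw [map_smul, ← Mc.integral_comp_comm hI, h1]
    congr 2; ext q
    rw [Mc_sandwich]
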